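/- Let n ≥ 2 and m ≥ 4, and let W be a social choice function for n agents over the alternatives [m] that is onto, strategyproof, and non-dictatorial. Then there exists T ⊆ [m] with |T| = m−3 such that the social choice function W_{−T} over the 3 alternatives [m]∖T is onto, strategyproof, and non-dictatorial. -/

import Mathlib

/-- A preference over `α`: a strict linear order, given as a relation that is
trichotomous, irreflexive and transitive. `σ.1 a b` means `a` is preferred to `b`. -/
def Pref (α : Type*) : Type _ :=
  {r : α → α → Prop //
    (∀ a b, r a b ∨ a = b ∨ r b a) ∧ (∀ a, ¬ r a a) ∧ (∀ a b c, r a b → r b c → r a c)}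

/-- Restriction `σ_{−B}` of a preference on `Fin m` to the alternatives outside `B`. -/
def restrictPref {m : ℕ} (B : Finset (Fin m)) (σ : Pref (Fin m)) :
    Pref {x : Fin m // x ∉ B} :=
  ⟨fun a b => σ.1 a.1 b.1, by
    obtain ⟨h1, h2, h3⟩ := σ.2
    refine ⟨fun a b => ?_, fun a => h2 a.1, fun a b c => h3 a.1 b.1 c.1⟩
    rcases h1 a.1 b.1 with h | h | h
    · exact Or.inl h
    · exact Or.inr (Or.inl (Subtype.ext h))
    · exact Or.inr (Or.inr h)⟩

/-- Extension `π^{+B}` of a preference `π` on `[m] ∖ B` to all of `Fin m`: it agrees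
with `π` outside `B`, places every alternative outside `B` before every alternative
in `B`, and orders `B` by the natural order on `Fin m`. -/
def extendPref {m : ℕ} (B : Finset (Fin m)) (π : Pref {x : Fin m // x ∉ B}) :
    Pref (Fin m) :=
  ⟨fun a b =>
    if ha : a ∈ B then b ∈ B ∧ a < b
    else if hb : b ∈ B then True
    else π.1 ⟨a, ha⟩ ⟨b, hb⟩, by
    obtain ⟨h1, h2, h3⟩ := π.2
    refine ⟨fun a b => ?_, fun a => ?_, fun a b c => ?_⟩
    · by_cases ha : a ∈ B <;> by_cases hb : b ∈ B <;> simp [ha, hb]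
      · rcases lt_trichotomy a b with h | h | h
        · exact Or.inl h
        · exact Or.inr (Or.inl h)
        · exact Or.inr (Or.inr h)
      · rcases h1 ⟨a, ha⟩ ⟨b, hb⟩ with h | h | h
        · exact Or.inl h
        · exact Or.inr (Or.inl (congrArg Subtype.val h))
        · exact Or.inr (Or.inr h)
    · by_cases ha : a ∈ B <;> simp [ha, h2]
    · by_cases ha : a ∈ B <;> by_cases hb : b ∈ B <;> by_cases hc : c ∈ B <;>
        simp [ha, hb, hc]
      · exact fun hab hbc => lt_trans hab hbc
      · exact fun hab hbc => h3 _ _ _ hab hbc⟩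

/-- Strategyproofness: no agent `i` can, by misreporting its preference as `π`,
obtain an outcome it strictly prefers (under its true preference `R i`). -/
def SCFStrategyproof {n : ℕ} {α : Type*} [DecidableEq (Fin n)]
    (W : (Fin n → Pref α) → α) : Prop :=
  ∀ (R : Fin n → Pref α) (i : Fin n) (π : Pref α),
    ¬ (R i).1 (W (Function.update R i π)) (W R)

/-- `a` is the most preferred element of the preference `σ`. -/
def PrefTop {α : Type*} (σ : Pref α) (a : α) : Prop := ∀ b, b ≠ a → σ.1 a b

/-- Some agent's top alternative is always the outcome of `W`. -/
def SCFDictatorial {n : ℕ} {α : Type*} (W : (Fin n → Pref α) → α) : Prop :=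
  ∃ i : Fin n, ∀ R : Fin n → Pref α, PrefTop (R i) (W R)

namespace Pref

theorem asymm {α : Type*} (p : Pref α) {a b : α} (h : p.1 a b) : ¬ p.1 b a :=
  fun hr => p.2.2.1 a (p.2.2.2 a b a h hr)

theorem of_not {α : Type*} (p : Pref α) {a b : α} (hne : a ≠ b) (h : ¬ p.1 b a) : p.1 a b := by
  rcases p.2.1 a b with hr | hr | hr
  · exact hr
  · exact absurd hr hne
  · exact absurd hr h

/-- Moves the alternatives in `S` to the top of `p`, keeping their relative order. -/
def raise {m : ℕ} (S : Finset (Fin m)) (p : Pref (Fin m)) : Pref (Fin m) :=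
  extendPref Sᶜ (restrictPref Sᶜ p)

theorem raise_iff {m : ℕ} {S : Finset (Fin m)} (p : Pref (Fin m)) {a : Fin m} (ha : a ∈ S)
    (b : Fin m) : (raise S p).1 a b ↔ (b ∈ S → p.1 a b) := by
  by_cases hb : b ∈ S <;> simp [raise, extendPref, restrictPref, ha, hb]

theorem raise_singleton {m : ℕ} (p : Pref (Fin m)) {a b : Fin m} (h : b ≠ a) :
    (raise {a} p).1 a b :=
  (raise_iff p (by simp) b).2 fun hb => absurd (Finset.mem_singleton.1 hb) h

end Pref

theorem extendPref_iff {m : ℕ} {B : Finset (Fin m)} (π : Pref {x : Fin m // x ∉ B})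
    (a b : {x : Fin m // x ∉ B}) : (extendPref B π).1 a b ↔ π.1 a b := by
  simp [extendPref, a.2, b.2]

theorem extendPref_of_notMem_of_mem {m : ℕ} {B : Finset (Fin m)}
    (π : Pref {x : Fin m // x ∉ B}) {a b : Fin m} (ha : a ∉ B) (hb : b ∈ B) :
    (extendPref B π).1 a b := by
  simp [extendPref, ha, hb]

namespace SCFStrategyproof

/-- Maskin monotonicity for a change in a single agent's report. -/
theorem update_eq {n : ℕ} {α : Type*} {W : (Fin n → Pref α) → α} (hsp : SCFStrategyproof W)
    (R : Fin n → Pref α) (i : Fin n) (π : Pref α)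
    (h : ∀ b, (R i).1 (W R) b → π.1 (W R) b) : W (Function.update R i π) = W R := by
  by_contra hne
  have h₁ := h _ ((R i).of_not (Ne.symm hne) (hsp R i π))
  have h₂ := hsp (Function.update R i π) i (R i)
  simp only [Function.update_idem, Function.update_eq_self, Function.update_self] at h₂
  exact h₂ h₁

/-- Maskin monotonicity. -/
theorem monotone {n : ℕ} {α : Type*} {W : (Fin n → Pref α) → α} (hsp : SCFStrategyproof W)
    {R R' : Fin n → Pref α} {a : α} (hR : W R = a)
    (h : ∀ i b, (R i).1 a b → (R' i).1 a b) : W R' = a := by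
  have key : ∀ s : Finset (Fin n), W (s.piecewise R' R) = a := by
    intro s
    induction s using Finset.induction_on with
    | empty => simpa using hR
    | insert i s hi ih =>
      rw [Finset.piecewise_insert, hsp.update_eq, ih]
      rw [ih, Finset.piecewise_eq_of_notMem _ _ _ hi]
      exact h i
  simpa using key Finset.univ

variable {m n : ℕ} {W : (Fin n → Pref (Fin m)) → Fin m}

/-- Onto strategyproof social choice functions never select a dominated alternative. -/
theorem pareto (hsp : SCFStrategyproof W) (honto : Function.Surjective W)
    {R : Fin n → Pref (Fin m)} {a b : Fin m} (hne : a ≠ b) (h : ∀ i, (R i).1 a b) :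
    W R ≠ b := by
  intro hb
  obtain ⟨R₀, ha⟩ := honto a
  have eb : W (fun i => (R i).raise {a, b}) = b :=
    hsp.monotone hb fun i c hc => (Pref.raise_iff _ (by simp) c).2 fun _ => hc
  have ea : W (fun i => (R i).raise {a, b}) = a := by
    refine hsp.monotone ha fun i c hc => (Pref.raise_iff _ (by simp) c).2 fun hcS => ?_
    rcases Finset.mem_insert.1 hcS with rfl | hcS
    · exact absurd hc ((R₀ i).2.2.1 c)
    · rw [Finset.mem_singleton.1 hcS]
      exact h i
  exact hne (ea.symm.trans eb)

theorem extendPref_notMem (hsp : SCFStrategyproof W) (honto : Function.Surjective W)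
    {T : Finset (Fin m)} {a : Fin m} (ha : a ∉ T) (R : Fin n → Pref {x : Fin m // x ∉ T}) :
    W (fun i => extendPref T (R i)) ∉ T := fun h =>
  hsp.pareto honto (ne_of_mem_of_not_mem h ha).symm
    (fun i => extendPref_of_notMem_of_mem (R i) ha h) rfl

end SCFStrategyproof

/-- `W_{−T}`, for an alternative set `T` that `W` avoids whenever everyone ranks it last. -/
def restrictSCF {m n : ℕ} (W : (Fin n → Pref (Fin m)) → Fin m) (T : Finset (Fin m))
    (hT : ∀ R : Fin n → Pref {x : Fin m // x ∉ T}, W (fun i => extendPref T (R i)) ∉ T)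
    (R : Fin n → Pref {x : Fin m // x ∉ T}) : {x : Fin m // x ∉ T} :=
  ⟨W fun i => extendPref T (R i), hT R⟩

section restrictSCF

variable {m n : ℕ} {W : (Fin n → Pref (Fin m)) → Fin m} {T : Finset (Fin m)}
  {hT : ∀ R : Fin n → Pref {x : Fin m // x ∉ T}, W (fun i => extendPref T (R i)) ∉ T}

theorem restrictSCF_surjective (hsp : SCFStrategyproof W) (honto : Function.Surjective W) :
    Function.Surjective (restrictSCF W T hT) := by
  intro a
  obtain ⟨R₀, -⟩ := honto a
  refine ⟨fun i => restrictPref T ((R₀ i).raise {a.1}), ?_⟩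
  by_contra hne
  refine hsp.pareto honto (a := a.1) (fun e => hne (Subtype.ext e.symm)) (fun i => ?_) rfl
  exact (extendPref_iff _ a (restrictSCF W T hT _)).2
    (Pref.raise_singleton _ fun e => hne (Subtype.ext e))

theorem restrictSCF_strategyproof (hsp : SCFStrategyproof W) :
    SCFStrategyproof (restrictSCF W T hT) := by
  intro R i π h
  refine hsp (fun j => extendPref T (R j)) i (extendPref T π) ?_
  have hu : Function.update (fun j => extendPref T (R j)) i (extendPref T π) =
      fun j => extendPref T (Function.update R i π j) := by
    funext j
    rcases eq_or_ne j i with rfl | hj <;> simp [*]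
  rw [hu]
  exact (extendPref_iff (R i) (restrictSCF W T hT _) (restrictSCF W T hT _)).2 h

end restrictSCF

/-- Agent `i` can impose `x` over `y` whenever everyone ranks these two alternatives on top. -/
def Decisive {m n : ℕ} (W : (Fin n → Pref (Fin m)) → Fin m) (i : Fin n) (x y : Fin m) : Prop :=
  ∀ R : Fin n → Pref (Fin m),
    (∀ j z, z ≠ x → z ≠ y → (R j).1 x z ∧ (R j).1 y z) → (R i).1 x y → W R = x

section Decisive

variable {m n : ℕ} {W : (Fin n → Pref (Fin m)) → Fin m}

theorem decisive_of_dictator (hsp : SCFStrategyproof W) {T : Finset (Fin m)}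
    {hT : ∀ R : Fin n → Pref {x : Fin m // x ∉ T}, W (fun i => extendPref T (R i)) ∉ T}
    {i : Fin n} (hi : ∀ R, PrefTop (R i) (restrictSCF W T hT R)) {x y : Fin m}
    (hx : x ∉ T) (hy : y ∉ T) : Decisive W i x y := by
  intro R htop hxy
  have hW : restrictSCF W T hT (fun j => restrictPref T (R j)) = ⟨x, hx⟩ := by
    by_contra hne
    have h : (R i).1 (restrictSCF W T hT fun j => restrictPref T (R j)) x :=
      hi (fun j => restrictPref T (R j)) ⟨x, hx⟩ (Ne.symm hne)
    refine (R i).asymm h ?_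
    by_cases hWy : (restrictSCF W T hT fun j => restrictPref T (R j)).1 = y
    · rwa [hWy]
    · exact (htop i _ (fun e => hne (Subtype.ext e)) hWy).1
  refine hsp.monotone (congrArg Subtype.val hW) fun j b hb => ?_
  by_cases hbx : b = x
  · subst hbx
    exact absurd hb ((extendPref T (restrictPref T (R j))).2.2.1 b)
  by_cases hby : b = y
  · subst hby
    exact (extendPref_iff (restrictPref T (R j)) ⟨x, hx⟩ ⟨b, hy⟩).1 hb
  · exact (htop j b hbx hby).1

theorem Decisive.agent_eq (hR : Nonempty (Fin n → Pref (Fin m))) {i j : Fin n} {x y : Fin m}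
    (hxy : x ≠ y) (hi : Decisive W i x y) (hj : Decisive W j y x) : i = j := by
  by_contra hij
  obtain ⟨R₀⟩ := hR
  let q : Fin n → Pref (Fin m) := fun k =>
    if k = i then (R₀ k).raise {x} else (R₀ k).raise {y}
  have htop : ∀ k z, z ≠ x → z ≠ y →
      ((q k).raise {x, y}).1 x z ∧ ((q k).raise {x, y}).1 y z := by
    intro k z hzx hzy
    constructor <;> exact (Pref.raise_iff _ (by simp) z).2 (by simp [hzx, hzy])
  have hx : W (fun k => (q k).raise {x, y}) = x := by
    refine hi _ htop ((Pref.raise_iff _ (by simp) y).2 fun _ => ?_)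
    simpa [q] using Pref.raise_singleton (R₀ i) hxy.symm
  have hy : W (fun k => (q k).raise {x, y}) = y := by
    refine hj _ (fun k z hzy hzx => (htop k z hzx hzy).symm)
      ((Pref.raise_iff _ (by simp) x).2 fun _ => ?_)
    simpa [q, Ne.symm hij] using Pref.raise_singleton (R₀ j) hxy
  exact hxy (hx.symm.trans hy)

/-- An agent decisive on every pair is a dictator. -/
theorem prefTop_of_decisive (hsp : SCFStrategyproof W) {i : Fin n}
    (h : ∀ x y, x ≠ y → Decisive W i x y) (R : Fin n → Pref (Fin m)) : PrefTop (R i) (W R) := by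
  intro a ha
  refine (R i).of_not ha.symm fun hab => ?_
  have hb : W (fun j => (R j).raise {a, W R}) = W R :=
    hsp.monotone rfl fun j c hc => (Pref.raise_iff _ (by simp) c).2 fun _ => hc
  have hWa : W (fun j => (R j).raise {a, W R}) = a := by
    refine h a (W R) ha _ (fun j z hza hzb => ?_) ((Pref.raise_iff _ (by simp) _).2 fun _ => hab)
    constructor <;> exact (Pref.raise_iff _ (by simp) z).2 (by simp [hza, hzb])
  exact ha (hWa.symm.trans hb)

/-- If every triple of alternatives has an agent decisive on all of its pairs, then one agent is
decisive on all pairs. -/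
theorem exists_decisive (hR : Nonempty (Fin n → Pref (Fin m))) (hm : 3 ≤ m)
    (h : ∀ x y z : Fin m, x ≠ y → x ≠ z → y ≠ z → ∃ i : Fin n,
      ∀ a ∈ ({x, y, z} : Finset (Fin m)), ∀ b ∈ ({x, y, z} : Finset (Fin m)), Decisive W i a b) :
    ∃ i, ∀ x y, x ≠ y → Decisive W i x y := by
  have step : ∀ i x y z, x ≠ y → x ≠ z → Decisive W i x y ∧ Decisive W i y x →
      Decisive W i x z ∧ Decisive W i z x := by
    intro i x y z hxy hxz hd
    rcases eq_or_ne y z with rfl | hyz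
    · exact hd
    obtain ⟨k, hk⟩ := h x y z hxy hxz hyz
    obtain rfl : i = k := hd.1.agent_eq hR hxy (hk y (by simp) x (by simp))
    exact ⟨hk x (by simp) z (by simp), hk z (by simp) x (by simp)⟩
  let x₀ : Fin m := ⟨0, by omega⟩
  let y₀ : Fin m := ⟨1, by omega⟩
  have hxy₀ : x₀ ≠ y₀ := by simp [x₀, y₀]
  obtain ⟨i, hi⟩ := h x₀ y₀ ⟨2, by omega⟩ hxy₀ (by simp [x₀]) (by simp [y₀])
  have hd : Decisive W i x₀ y₀ ∧ Decisive W i y₀ x₀ :=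
    ⟨hi _ (by simp) _ (by simp), hi _ (by simp) _ (by simp)⟩
  refine ⟨i, fun x y hxy => ?_⟩
  rcases eq_or_ne x₀ x with rfl | hx
  · exact (step i _ _ y hxy₀ hxy hd).1
  · exact (step i x x₀ y hx.symm hxy (step i x₀ y₀ x hxy₀ hx hd).symm).1

end Decisive

theorem stmt19 (m n : ℕ) (hn : 2 ≤ n) (hm : 4 ≤ m)
    (W : (Fin n → Pref (Fin m)) → Fin m)
    (honto : Function.Surjective W) (hsp : SCFStrategyproof W)
    (hND : ¬ SCFDictatorial W) :
    ∃ T : Finset (Fin m), T.card = m - 3 ∧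
      ∃ W' : (Fin n → Pref {x : Fin m // x ∉ T}) → {x : Fin m // x ∉ T},
        (∀ R, (W' R : Fin m) = W (fun i => extendPref T (R i))) ∧
        Function.Surjective W' ∧ SCFStrategyproof W' ∧ ¬ SCFDictatorial W' := by
  by_contra hcon
  obtain ⟨R₀, -⟩ := honto ⟨0, by omega⟩
  obtain ⟨i, hi⟩ := exists_decisive (W := W) ⟨R₀⟩ (by omega) fun x y z hxy hxz hyz => by
    have hcard : ({x, y, z} : Finset (Fin m))ᶜ.card = m - 3 := by
      rw [Finset.card_compl, Fintype.card_fin, Finset.card_eq_three.2 ⟨x, y, z, hxy, hxz, hyz, rfl⟩]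
    have hT := hsp.extendPref_notMem honto (T := ({x, y, z} : Finset (Fin m))ᶜ) (a := x) (by simp)
    by_contra hno
    refine hcon ⟨_, hcard, restrictSCF W _ hT, fun _ => rfl, restrictSCF_surjective hsp honto,
      restrictSCF_strategyproof hsp, ?_⟩
    rintro ⟨k, hk⟩
    exact hno ⟨k, fun a ha b hb => decisive_of_dictator hsp hk
      (fun h => Finset.mem_compl.1 h ha) (fun h => Finset.mem_compl.1 h hb)⟩
  exact hND ⟨i, prefTop_of_decisive hsp hi⟩
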